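/- Let δ(y) = 0 for 0 < y < 1, δ(1) = 1/2, and δ(y) = 1 for y > 1. Then for all y > 0, a > 0, T > 0: |(1/(2πi)) ∫_{a−iT}^{a+iT} y^s/s ds − δ(y)| < y^a · min{1, 1/(T·|log y|)} if y ≠ 1, and the bound is a/T if y = 1. -/

import Mathlib

noncomputable def perronDelta (y : ℝ) : ℂ :=
  if y < 1 then 0 else if y = 1 then 1 / 2 else 1

lemma perron_cos_lower {ψ θ : ℝ} (hψ : ψ < Real.pi) (h0 : 0 ≤ θ) (h1 : θ ≤ ψ) :
    Real.sin ψ / Real.pi * (ψ - θ) ≤ Real.cos θ - Real.cos ψ := by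
  have hpi := Real.pi_pos
  have e : Real.cos θ - Real.cos ψ
      = 2 * Real.sin ((ψ + θ) / 2) * Real.sin ((ψ - θ) / 2) := by
    rw [Real.cos_sub_cos, ← neg_sub ψ θ, neg_div, Real.sin_neg, add_comm θ ψ]
    ring
  have hs : 2 / Real.pi * ((ψ - θ) / 2) ≤ Real.sin ((ψ - θ) / 2) :=
    Real.mul_le_sin (by linarith) (by linarith)
  have hψ0 : 0 ≤ Real.sin ψ := Real.sin_nonneg_of_nonneg_of_le_pi (by linarith) hψ.le
  have hhalf : Real.sin ψ / 2 ≤ Real.sin (ψ / 2) := by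
    have h2 : Real.sin ψ = 2 * Real.sin (ψ / 2) * Real.cos (ψ / 2) := by
      rw [← Real.sin_two_mul]; congr 1; ring
    have h3 : 0 ≤ Real.sin (ψ / 2) :=
      Real.sin_nonneg_of_nonneg_of_le_pi (by linarith) (by linarith)
    have h4 := Real.cos_le_one (ψ / 2)
    nlinarith
  have hm : Real.sin ψ / 2 ≤ Real.sin ((ψ + θ) / 2) := by
    rcases le_total ((ψ + θ) / 2) (Real.pi / 2) with h | h
    · exact hhalf.trans (Real.sin_le_sin_of_le_of_le_pi_div_two (by linarith) h (by linarith))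
    · have h5 : Real.sin (Real.pi - ψ) ≤ Real.sin (Real.pi - (ψ + θ) / 2) :=
        Real.sin_le_sin_of_le_of_le_pi_div_two (by linarith) (by linarith) (by linarith)
      rw [Real.sin_pi_sub, Real.sin_pi_sub] at h5
      linarith
  rw [e]
  have h6 : 0 ≤ 2 / Real.pi * ((ψ - θ) / 2) := by
    have : 0 ≤ (ψ - θ) / 2 := by linarith
    positivity
  calc Real.sin ψ / Real.pi * (ψ - θ)
      = 2 * (Real.sin ψ / 2) * (2 / Real.pi * ((ψ - θ) / 2)) := by field_simp
    _ ≤ _ := by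
      apply mul_le_mul _ hs h6
      · linarith
      · linarith

lemma perron_norm (k θ : ℝ) :
    ‖Complex.exp (((-k : ℝ) : ℂ) * Complex.exp (θ * Complex.I)) * Complex.I‖
      = Real.exp (-k * Real.cos θ) := by
  rw [norm_mul, Complex.norm_I, mul_one, Complex.norm_exp, Complex.re_ofReal_mul,
    Complex.exp_ofReal_mul_I_re]

lemma perron_cont (k : ℝ) : Continuous fun θ : ℝ =>
    Complex.exp (((-k : ℝ) : ℂ) * Complex.exp (θ * Complex.I)) * Complex.I := by
  fun_prop

lemma perron_arc_one {k ψ : ℝ} (hk : 0 < k) (h0 : 0 < ψ) (hψ : ψ < Real.pi) :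
    ‖∫ θ in (-ψ)..ψ, Complex.exp (((-k : ℝ) : ℂ) * Complex.exp (θ * Complex.I)) * Complex.I‖
      < 2 * Real.pi * Real.exp (-k * Real.cos ψ) := by
  have h : ∀ θ ∈ Set.uIoc (-ψ) ψ,
      ‖Complex.exp (((-k : ℝ) : ℂ) * Complex.exp (θ * Complex.I)) * Complex.I‖
        ≤ Real.exp (-k * Real.cos ψ) := by
    intro θ hθ
    rw [Set.uIoc_of_le (by linarith)] at hθ
    rw [perron_norm]
    have h1 : Real.cos ψ ≤ Real.cos θ := by
      rw [← Real.cos_abs θ]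
      exact Real.cos_le_cos_of_nonneg_of_le_pi (abs_nonneg _) hψ.le
        (abs_le.mpr ⟨hθ.1.le, hθ.2⟩)
    apply Real.exp_le_exp.mpr
    nlinarith
  refine (intervalIntegral.norm_integral_le_of_norm_le_const h).trans_lt ?_
  rw [abs_of_nonneg (by linarith)]
  have := Real.exp_pos (-k * Real.cos ψ)
  nlinarith

lemma perron_int {m ψ : ℝ} (hm : 0 < m) (M : ℝ) (hM : 0 < M) :
    ∫ θ in (0 : ℝ)..ψ, M * Real.exp (-m * (ψ - θ)) < M / m := by
  have h : ∀ θ ∈ Set.uIcc 0 ψ, HasDerivAt (fun θ => M / m * Real.exp (-m * (ψ - θ)))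
      (M * Real.exp (-m * (ψ - θ))) θ := by
    intro θ _
    have h1 : HasDerivAt (fun θ : ℝ => -m * (ψ - θ)) (-m * (-1)) θ :=
      ((hasDerivAt_id θ).const_sub ψ).const_mul (-m)
    refine ((h1.exp).const_mul (M / m)).congr_deriv ?_
    field_simp
  rw [intervalIntegral.integral_eq_sub_of_hasDerivAt h
    (Continuous.intervalIntegrable (by fun_prop) _ _)]
  have h2 : 0 < M / m * Real.exp (-m * (ψ - 0)) := by positivity
  simp only [sub_self, mul_zero, Real.exp_zero, mul_one]
  linarith

lemma perron_arc_two {k ψ : ℝ} (hk : 0 < k) (h0 : 0 < ψ) (hψ : ψ < Real.pi) :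
    ‖∫ θ in (-ψ)..ψ, Complex.exp (((-k : ℝ) : ℂ) * Complex.exp (θ * Complex.I)) * Complex.I‖
      < 2 * Real.pi * (Real.exp (-k * Real.cos ψ) * (1 / (k * Real.sin ψ))) := by
  have hpi := Real.pi_pos
  have hs : 0 < Real.sin ψ := Real.sin_pos_of_pos_of_lt_pi h0 hψ
  set M := Real.exp (-k * Real.cos ψ) with hMdef
  have hM : 0 < M := Real.exp_pos _
  set m := k * (Real.sin ψ / Real.pi) with hm
  have hm0 : 0 < m := by positivity
  have key : ∀ θ, 0 ≤ θ → θ ≤ ψ →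
      Real.exp (-k * Real.cos θ) ≤ M * Real.exp (-m * (ψ - θ)) := by
    intro θ h1 h2
    rw [hMdef, ← Real.exp_add]
    apply Real.exp_le_exp.mpr
    have := mul_le_mul_of_nonneg_left (perron_cos_lower hψ h1 h2) hk.le
    rw [hm]
    nlinarith
  have hR : ‖∫ θ in (0 : ℝ)..ψ,
      Complex.exp (((-k : ℝ) : ℂ) * Complex.exp (θ * Complex.I)) * Complex.I‖ < M / m := by
    refine (intervalIntegral.norm_integral_le_of_norm_le h0.le
      (g := fun θ => M * Real.exp (-m * (ψ - θ))) ?_ ?_).trans_lt (perron_int hm0 M hM)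
    · filter_upwards with θ hθ
      rw [perron_norm]
      exact key θ hθ.1.le hθ.2
    · exact Continuous.intervalIntegrable (by fun_prop) _ _
  have hL : ‖∫ θ in (-ψ)..0,
      Complex.exp (((-k : ℝ) : ℂ) * Complex.exp (θ * Complex.I)) * Complex.I‖ < M / m := by
    have e := intervalIntegral.integral_comp_neg (a := 0) (b := ψ) (fun θ : ℝ =>
      Complex.exp (((-k : ℝ) : ℂ) * Complex.exp (θ * Complex.I)) * Complex.I)
    rw [neg_zero] at e
    rw [← e]
    refine (intervalIntegral.norm_integral_le_of_norm_le h0.le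
      (g := fun θ => M * Real.exp (-m * (ψ - θ))) ?_ ?_).trans_lt (perron_int hm0 M hM)
    · filter_upwards with θ hθ
      rw [perron_norm, Real.cos_neg]
      exact key θ hθ.1.le hθ.2
    · exact Continuous.intervalIntegrable (by fun_prop) _ _
  rw [← intervalIntegral.integral_add_adjacent_intervals
    ((perron_cont k).intervalIntegrable (-ψ) 0) ((perron_cont k).intervalIntegrable 0 ψ)]
  refine (norm_add_le _ _).trans_lt ?_
  have : 2 * Real.pi * (M * (1 / (k * Real.sin ψ))) = M / m + M / m := by
    rw [hm]; field_simp; ring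
  rw [this]
  exact add_lt_add hL hR

lemma perron_primitive (L : ℝ) : ∃ E : ℂ → ℂ, ∀ s : ℂ, s ≠ 0 →
    HasDerivAt E ((Complex.exp (L * s) - 1) / s) s := by
  have hd : Differentiable ℂ (dslope (fun s : ℂ => Complex.exp (L * s)) 0) := by
    rw [← differentiableOn_univ, Complex.differentiableOn_dslope Filter.univ_mem,
      differentiableOn_univ]
    fun_prop
  obtain ⟨E, hE⟩ := hd.isExactOn_univ
  refine ⟨E, fun s hs => ?_⟩
  have := hE s (Set.mem_univ s)
  rw [dslope_of_ne _ hs] at this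
  refine this.congr_deriv ?_
  simp [slope_def_field]

lemma perron_arc_eq (L c ψ : ℝ) (hc : c ≠ 0) (E : ℂ → ℂ) (hE : ∀ s : ℂ, s ≠ 0 →
    HasDerivAt E ((Complex.exp (L * s) - 1) / s) s) :
    ∫ θ in (-ψ)..ψ, Complex.exp (((L * c : ℝ) : ℂ) * Complex.exp (θ * Complex.I)) * Complex.I
      = E (c * Complex.exp (ψ * Complex.I)) - E (c * Complex.exp (-(ψ * Complex.I)))
        + 2 * ψ * Complex.I := by
  have h : ∀ θ ∈ Set.uIcc (-ψ) ψ, HasDerivAt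
      (fun θ : ℝ => E (c * Complex.exp (θ * Complex.I)) + θ * Complex.I)
      (Complex.exp (((L * c : ℝ) : ℂ) * Complex.exp (θ * Complex.I)) * Complex.I) θ := by
    intro θ _
    have h0 : HasDerivAt (fun θ : ℝ => (θ : ℂ) * Complex.I) (1 * Complex.I) θ :=
      (Complex.ofRealCLM.hasDerivAt (x := θ)).mul_const Complex.I
    have h1 := h0.cexp.const_mul (c : ℂ)
    have hc' : (c : ℂ) ≠ 0 := by exact_mod_cast hc
    have hne : (c : ℂ) * Complex.exp (θ * Complex.I) ≠ 0 :=
      mul_ne_zero hc' (Complex.exp_ne_zero _)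
    have h2 := ((hE _ hne).comp θ h1).add h0
    refine HasDerivAt.congr_deriv h2 ?_
    have := Complex.exp_ne_zero (θ * Complex.I)
    push_cast
    rw [mul_assoc (L : ℂ)]
    field_simp
    ring
  rw [intervalIntegral.integral_eq_sub_of_hasDerivAt h
    (Continuous.intervalIntegrable (by fun_prop) _ _)]
  push_cast
  rw [neg_mul]
  ring

lemma perron_chord_eq (L R φ : ℝ) (hR : 0 < R) (h0 : 0 < φ) (hφ : φ < Real.pi / 2)
    (E : ℂ → ℂ) (hE : ∀ s : ℂ, s ≠ 0 →
    HasDerivAt E ((Complex.exp (L * s) - 1) / s) s) :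
    ∫ t in (-(R * Real.sin φ))..(R * Real.sin φ),
      Complex.exp (L * (((R * Real.cos φ : ℝ) : ℂ) + t * Complex.I)) /
        (((R * Real.cos φ : ℝ) : ℂ) + t * Complex.I) * Complex.I
      = E (R * Complex.exp (φ * Complex.I)) - E (R * Complex.exp (-(φ * Complex.I)))
        + 2 * φ * Complex.I := by
  have hcos : 0 < R * Real.cos φ :=
    mul_pos hR (Real.cos_pos_of_mem_Ioo ⟨by linarith, hφ⟩)
  have hre : ∀ t : ℝ, 0 < (((R * Real.cos φ : ℝ) : ℂ) + t * Complex.I).re := by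
    intro t; rw [Complex.add_re, Complex.ofReal_re, Complex.re_ofReal_mul]; simpa only [Complex.I_re, mul_zero, add_zero] using hcos
  have hnz : ∀ t : ℝ, (((R * Real.cos φ : ℝ) : ℂ) + t * Complex.I) ≠ 0 := by
    intro t h
    have := hre t
    rw [h] at this
    simp at this
  have h : ∀ t ∈ Set.uIcc (-(R * Real.sin φ)) (R * Real.sin φ), HasDerivAt
      (fun t : ℝ => E (((R * Real.cos φ : ℝ) : ℂ) + t * Complex.I)
        + Complex.log (((R * Real.cos φ : ℝ) : ℂ) + t * Complex.I))
      (Complex.exp (L * (((R * Real.cos φ : ℝ) : ℂ) + t * Complex.I)) /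
        (((R * Real.cos φ : ℝ) : ℂ) + t * Complex.I) * Complex.I) t := by
    intro t _
    have h1 : HasDerivAt (fun t : ℝ => ((R * Real.cos φ : ℝ) : ℂ) + t * Complex.I)
        (1 * Complex.I) t :=
      ((Complex.ofRealCLM.hasDerivAt (x := t)).mul_const Complex.I).const_add _
    have h2 := ((hE _ (hnz t)).comp t h1).add (h1.clog_real (Or.inl (hre t)))
    refine HasDerivAt.congr_deriv h2 ?_
    have := hnz t
    field_simp
    ring
  rw [intervalIntegral.integral_eq_sub_of_hasDerivAt h
    (Continuous.intervalIntegrable (by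
      refine Continuous.mul (Continuous.div (by fun_prop) (by fun_prop) hnz) (by fun_prop)) _ _)]
  have hpi := Real.pi_pos
  have hRe : (R : ℂ) = Complex.exp (Real.log R : ℝ) := by
    rw [← Complex.ofReal_exp, Real.exp_log hR]
  have e1 : (((R * Real.cos φ : ℝ) : ℂ) + (R * Real.sin φ : ℝ) * Complex.I)
      = R * Complex.exp (φ * Complex.I) := by
    rw [Complex.exp_mul_I]; push_cast; ring
  have e2 : (((R * Real.cos φ : ℝ) : ℂ) + (-(R * Real.sin φ) : ℝ) * Complex.I)
      = R * Complex.exp (-(φ * Complex.I)) := by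
    rw [← neg_mul (φ : ℂ), Complex.exp_mul_I, Complex.cos_neg, Complex.sin_neg]; push_cast; ring
  have l1 : Complex.log (R * Complex.exp (φ * Complex.I)) = Real.log R + φ * Complex.I := by
    rw [hRe, ← Complex.exp_add, Complex.log_exp] <;> simp <;> linarith
  have l2 : Complex.log (R * Complex.exp (-(φ * Complex.I))) = Real.log R - φ * Complex.I := by
    rw [hRe, ← Complex.exp_add, Complex.log_exp] 
    · ring
    · simp; linarith
    · simp; linarith
  rw [e1, e2, l1, l2]
  ring

lemma perron_polar {a T : ℝ} (ha : 0 < a) (hT : 0 < T) : ∃ R φ : ℝ, 0 < R ∧ 0 < φ ∧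
    φ < Real.pi / 2 ∧ a = R * Real.cos φ ∧ T = R * Real.sin φ := by
  have hdiv : 0 < T / a := by positivity
  have hc := Real.cos_arctan_pos (T / a)
  refine ⟨a / Real.cos (Real.arctan (T / a)), Real.arctan (T / a), by positivity,
    Real.arctan_pos.mpr hdiv, Real.arctan_lt_pi_div_two _, ?_, ?_⟩
  · field_simp
  · have h := Real.tan_arctan (T / a)
    rw [Real.tan_eq_sin_div_cos] at h
    rw [div_mul_eq_mul_div, mul_div_assoc, h]
    field_simp

lemma perron_norm_scale (z : ℂ) (B : ℝ) (h : ‖z‖ < 2 * Real.pi * B) :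
    ‖(1 / (2 * Real.pi * Complex.I)) * z‖ < B := by
  have hpi := Real.pi_pos
  rw [norm_mul]
  have : ‖(1 / (2 * Real.pi * Complex.I) : ℂ)‖ = 1 / (2 * Real.pi) := by
    simp [abs_of_pos hpi]
  rw [this, one_div_mul_eq_div, div_lt_iff₀ (by positivity)]
  linarith

/-- Truncated Perron formula: for `y, a, T > 0`,
`|(1/2πi) ∫_{a−iT}^{a+iT} y^s/s ds − δ(y)|` is at most
`y^a min{1, 1/(T |log y|)}` when `y ≠ 1`, and at most `a/T` when `y = 1`. -/
theorem truncated_perron (y a T : ℝ) (hy : 0 < y) (ha : 0 < a) (hT : 0 < T) :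
    (y ≠ 1 →
      ‖(1 / (2 * Real.pi * Complex.I)) *
          (∫ t in (-T)..T,
            (y : ℂ) ^ ((a : ℂ) + t * Complex.I) / ((a : ℂ) + t * Complex.I) *
              Complex.I) - perronDelta y‖ <
        y ^ a * min 1 (1 / (T * |Real.log y|))) ∧
    (y = 1 →
      ‖(1 / (2 * Real.pi * Complex.I)) *
          (∫ t in (-T)..T,
            (y : ℂ) ^ ((a : ℂ) + t * Complex.I) / ((a : ℂ) + t * Complex.I) *
              Complex.I) - perronDelta y‖ < a / T) := by
  obtain ⟨R, φ, hR, h0, hφ, rfl, rfl⟩ := perron_polar ha hT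
  have hpi := Real.pi_pos
  have hpiC : (Real.pi : ℂ) ≠ 0 := by exact_mod_cast hpi.ne'
  have hIC := Complex.I_ne_zero
  have hpow : ∀ s : ℂ, (y : ℂ) ^ s = Complex.exp ((Real.log y : ℝ) * s) := by
    intro s
    rw [Complex.cpow_def_of_ne_zero (by exact_mod_cast hy.ne'), Complex.ofReal_log hy.le]
  obtain ⟨E, hE⟩ := perron_primitive (Real.log y)
  have hchord := perron_chord_eq (Real.log y) R φ hR h0 hφ E hE
  simp only [hpow]
  rw [hchord]
  refine ⟨fun hne => ?_, fun h1 => ?_⟩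
  · rw [mul_min_of_nonneg _ _ (by positivity), Real.rpow_def_of_pos hy]
    rcases lt_or_gt_of_ne hne with hlt | hgt
    · have hL : Real.log y < 0 := Real.log_neg hy hlt
      have hk : 0 < -(Real.log y * R) := by nlinarith
      have harc := perron_arc_eq (Real.log y) R φ hR.ne' E hE
      have b1 := perron_arc_one hk h0 (by linarith)
      have b2 := perron_arc_two hk h0 (by linarith)
      rw [neg_neg, harc] at b1 b2
      rw [perronDelta, if_pos hlt, sub_zero, abs_of_neg hL]
      refine perron_norm_scale _ _ ?_
      rw [mul_min_of_nonneg _ _ (by positivity)]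
      refine lt_min ?_ ?_
      · refine b1.trans_eq ?_
        ring_nf
      · refine b2.trans_eq ?_
        ring_nf
    · have hL : 0 < Real.log y := Real.log_pos hgt
      have hk : 0 < Real.log y * R := by positivity
      have harc := perron_arc_eq (Real.log y) (-R) (Real.pi - φ) (by linarith) E hE
      have b1 := perron_arc_one hk (ψ := Real.pi - φ) (by linarith) (by linarith)
      have b2 := perron_arc_two hk (ψ := Real.pi - φ) (by linarith) (by linarith)
      rw [← mul_neg, harc, Real.cos_pi_sub] at b1 b2
      rw [Real.sin_pi_sub] at b2
      have e1 : ((-R : ℝ) : ℂ) * Complex.exp ((Real.pi - φ : ℝ) * Complex.I)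
          = R * Complex.exp (-(φ * Complex.I)) := by
        have : ((Real.pi - φ : ℝ) : ℂ) * Complex.I
            = Real.pi * Complex.I + -(φ * Complex.I) := by push_cast; ring
        rw [this, Complex.exp_add, Complex.exp_pi_mul_I]; push_cast; ring
      have e2 : ((-R : ℝ) : ℂ) * Complex.exp (-((Real.pi - φ : ℝ) * Complex.I))
          = R * Complex.exp (φ * Complex.I) := by
        have : -(((Real.pi - φ : ℝ) : ℂ) * Complex.I)
            = -(Real.pi * Complex.I) + φ * Complex.I := by push_cast; ring
        rw [this, Complex.exp_add, Complex.exp_neg, Complex.exp_pi_mul_I]; push_cast; ring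
      rw [e1, e2] at b1 b2
      rw [perronDelta, if_neg (by linarith), if_neg hne, abs_of_pos hL]
      have e3 : ∀ z w : ℂ, 1 / (2 * Real.pi * Complex.I) * (z - w + 2 * φ * Complex.I) - 1
          = 1 / (2 * Real.pi * Complex.I) *
            (-(w - z + 2 * ((Real.pi - φ : ℝ) : ℂ) * Complex.I)) := by
        intro z w
        push_cast
        field_simp
        ring
      rw [e3]
      refine perron_norm_scale _ _ ?_
      rw [norm_neg, mul_min_of_nonneg _ _ (by positivity)]
      refine lt_min ?_ ?_
      · refine b1.trans_eq ?_
        ring_nf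
      · refine b2.trans_eq ?_
        ring_nf
  · have hdelta : perronDelta y = 1 / 2 := by simp [perronDelta, h1]
    have hconst : E (R * Complex.exp (φ * Complex.I))
        - E (R * Complex.exp (-(φ * Complex.I))) = 0 := by
      have h := perron_arc_eq (Real.log y) R φ hR.ne' E hE
      rw [h1, Real.log_one] at h
      simp only [zero_mul, Complex.ofReal_zero, Complex.exp_zero, one_mul,
        intervalIntegral.integral_const, Complex.real_smul] at h
      push_cast at h
      linear_combination -h
    rw [hconst, hdelta]
    have e : 1 / (2 * Real.pi * Complex.I) * (0 + 2 * φ * Complex.I) - 1 / 2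
        = ((-((Real.pi / 2 - φ) / Real.pi) : ℝ) : ℂ) := by
      push_cast
      field_simp
      ring
    rw [e, Complex.norm_real, norm_neg, Real.norm_of_nonneg
      (div_nonneg (by linarith) hpi.le)]
    have ht := Real.lt_tan (x := Real.pi / 2 - φ) (by linarith) (by linarith)
    rw [Real.tan_pi_div_two_sub, Real.tan_eq_sin_div_cos, inv_div] at ht
    rw [mul_div_mul_left _ _ hR.ne']
    refine lt_of_le_of_lt ?_ ht
    exact div_le_self (by linarith) (by linarith [Real.pi_gt_three])
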